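/- Let θ⁰ ∈ ℓ²(ℤ;ℂ), let ℓ ≥ 1 be an integer, and let θ⁰_ℓ denote the truncation of θ⁰ defined by (θ⁰_ℓ)_k = θ⁰_k for |k| ≤ ℓ and (θ⁰_ℓ)_k = 0 for |k| > ℓ. Then for every Borel probability measure g⁰ on [0,1], P_{θ⁰,g⁰} is absolutely continuous with respect to P_{θ⁰_ℓ,g⁰} and KL(P_{θ⁰,g⁰} ‖ P_{θ⁰_ℓ,g⁰}) ≤ 2 ‖θ⁰ − θ⁰_ℓ‖². Consequently d_H(P_{θ⁰,g⁰}, P_{θ⁰_ℓ,g⁰}) ≤ √2 ‖θ⁰ − θ⁰_ℓ‖, and if additionally Q_s := (Σ_{k∈ℤ} |k|^{2s} |θ⁰_k|²)^{1/2} < ∞ for some s ≥ 1, then d_H(P_{θ⁰,g⁰}, P_{θ⁰_ℓ,g⁰}) ≤ √2 Q_s ℓ^{−s}. -/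

import Mathlib

open MeasureTheory Real Set

/-- the standard complex Gaussian probability measure N_ℂ(μ,1) on ℂ,
with Lebesgue density z ↦ π⁻¹ e^{−|z−μ|²} -/
noncomputable def gaussC (μ : ℂ) : Measure ℂ :=
  volume.withDensity (fun z => ENNReal.ofReal (Real.pi⁻¹ * Real.exp (-‖z - μ‖ ^ 2)))

/-- the rotated sequence (θ•φ)_k = θ_k e^{−2iπkφ} -/
noncomputable def rotZ (θ : ℤ → ℂ) (φ : ℝ) : ℤ → ℂ :=
  fun k => θ k * Complex.exp (-Complex.I * (2 * Real.pi * (k : ℝ) * φ))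

/-- `P` is the product measure ⊗_{k∈ℤ} N_ℂ(θ_k e^{−2iπkφ}, 1) on ℂ^ℤ (product σ-algebra),
characterized as the projective limit of its finite-dimensional Gaussian product marginals. -/
def IsGaussProduct (θ : ℤ → ℂ) (φ : ℝ) (P : Measure (ℤ → ℂ)) : Prop :=
  IsProbabilityMeasure P ∧
    IsProjectiveLimit P (fun J : Finset ℤ => Measure.pi (fun k : J => gaussC (rotZ θ φ k)))

/-- g is a Borel probability measure on [0,1] (encoded as a measure on ℝ carried by [0,1]) -/
def IsProbOn01 (g : MeasureTheory.Measure ℝ) : Prop :=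
  MeasureTheory.IsProbabilityMeasure g ∧ g (Set.Icc 0 1) = 1

/-- `P` is the mixture P_{θ,g}(A) = ∫₀¹ (⊗_{k∈ℤ} N_ℂ(θ_k e^{−2iπkφ},1))(A) dg(φ) on ℂ^ℤ. -/
def IsMixtureLaw (θ : ℤ → ℂ) (g : Measure ℝ) (P : Measure (ℤ → ℂ)) : Prop :=
  ∃ Pp : ℝ → Measure (ℤ → ℂ), (∀ φ : ℝ, IsGaussProduct θ φ (Pp φ)) ∧
    ∀ A : Set (ℤ → ℂ), MeasurableSet A → P A = ∫⁻ φ, Pp φ A ∂g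

/-- Hellinger distance between two measures (computed through densities with respect to
the dominating measure P + Q; it does not depend on this choice). -/
noncomputable def dH {X : Type*} [MeasurableSpace X] (P Q : Measure X) : ℝ :=
  Real.sqrt (∫ x, (Real.sqrt ((P.rnDeriv (P + Q) x).toReal)
      - Real.sqrt ((Q.rnDeriv (P + Q) x).toReal)) ^ 2 ∂(P + Q))

/-- total variation distance between two measures: sup over measurable sets A of |P(A) − Q(A)| -/
noncomputable def dTV {X : Type*} [MeasurableSpace X] (P Q : Measure X) : ℝ :=
  ⨆ (A : Set X) (_ : MeasurableSet A), |(P A).toReal - (Q A).toReal|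

/-- the ℓ²(ℤ) norm of a sequence -/
noncomputable def l2norm (θ : ℤ → ℂ) : ℝ := Real.sqrt (∑' k : ℤ, ‖θ k‖ ^ 2)

/-- Kullback–Leibler divergence KL(P‖Q) = ∫ log (dP/dQ) dP -/
noncomputable def dKL {X : Type*} [MeasurableSpace X] (P Q : Measure X) : ℝ :=
  ∫ x, Real.log ((P.rnDeriv Q x).toReal) ∂P

/-- truncation of a sequence to the frequencies |k| ≤ ℓ -/
noncomputable def trunc (θ : ℤ → ℂ) (ℓ : ℕ) : ℤ → ℂ :=
  fun k => if |k| ≤ (ℓ : ℤ) then θ k else 0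


open scoped ENNReal

/-- For all bounded measurable `f ≥ 0`, `(∫ f dP)² ≤ C ∫ f² dQ`. This is the dual form of the bound
`∫ (dP/dQ)² dQ ≤ C`. -/
def ChiSqBound {X : Type*} [MeasurableSpace X] (P Q : Measure X) (C : ℝ≥0∞) : Prop :=
  ∀ f : X → ℝ, Measurable f → (∀ x, 0 ≤ f x) → (∃ M, ∀ x, f x ≤ M) →
    (∫⁻ x, ENNReal.ofReal (f x) ∂P) ^ 2 ≤ C * ∫⁻ x, ENNReal.ofReal (f x) ^ 2 ∂Q

namespace ChiSqBound

variable {X : Type*} [MeasurableSpace X] {P Q : Measure X} {C : ℝ≥0∞}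

theorem measure_sq_le (h : ChiSqBound P Q C) {A : Set X} (hA : MeasurableSet A) :
    P A ^ 2 ≤ C * Q A := by
  have key := h (A.indicator 1) (measurable_one.indicator hA)
    (fun x => indicator_nonneg (fun _ _ => zero_le_one) x)
    ⟨1, fun x => indicator_le_self' (fun _ _ => zero_le_one) x⟩
  have h1 : ∀ x, ENNReal.ofReal (A.indicator (1 : X → ℝ) x) = A.indicator 1 x := fun x => by
    by_cases hx : x ∈ A <;> simp [hx]
  have h2 : ∀ x, A.indicator (1 : X → ℝ≥0∞) x ^ 2 = A.indicator 1 x := fun x => by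
    by_cases hx : x ∈ A <;> simp [hx]
  simpa only [h1, h2, lintegral_indicator_one hA] using key

theorem absolutelyContinuous (h : ChiSqBound P Q C) : P ≪ Q := by
  refine Measure.AbsolutelyContinuous.mk fun A hA hQA => ?_
  simpa [hQA] using h.measure_sq_le hA

theorem lintegral_rnDeriv_le [IsFiniteMeasure P] [IsFiniteMeasure Q] (h : ChiSqBound P Q C) :
    ∫⁻ x, P.rnDeriv Q x ∂P ≤ C := by
  have hac := h.absolutelyContinuous
  set L := P.rnDeriv Q with hL
  have hLm : Measurable L := Measure.measurable_rnDeriv _ _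
  let F : ℕ → X → ℝ≥0∞ := fun n x => min (L x) n
  have hFm : ∀ n, Measurable (F n) := fun n => hLm.min measurable_const
  have hFn : ∀ n x, F n x ≤ n := fun n x => min_le_right _ _
  have hFt : ∀ n x, F n x ≠ ∞ := fun n x =>
    ne_top_of_le_ne_top (ENNReal.natCast_ne_top n) (hFn n x)
  have hsq : ∀ n, ∫⁻ x, L x * F n x ∂Q ≤ C := fun n => by
    have key := h (fun x => (F n x).toReal) (hFm n).ennreal_toReal (fun _ => ENNReal.toReal_nonneg)
      ⟨n, fun x => ENNReal.toReal_le_of_le_ofReal (by positivity) (by simpa using hFn n x)⟩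
    simp only [ENNReal.ofReal_toReal (hFt n _)] at key
    rw [← lintegral_rnDeriv_mul hac (hFm n).aemeasurable] at key
    set J := ∫⁻ x, L x * F n x ∂Q with hJ
    have hJt : J ≠ ∞ := by
      rw [hJ, lintegral_rnDeriv_mul hac (hFm n).aemeasurable]
      refine ne_top_of_le_ne_top ?_ (lintegral_mono (hFn n))
      simpa using ENNReal.mul_ne_top (ENNReal.natCast_ne_top n) (measure_ne_top P _)
    have hle : J ^ 2 ≤ C * J := key.trans <| by
      gcongr
      exact lintegral_mono fun x => by
        rw [sq]; gcongr; exact min_le_left _ _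
    by_cases hJ0 : J = 0
    · simp [hJ0]
    · rw [sq] at hle
      exact (ENNReal.mul_le_mul_iff_left hJ0 hJt).1 hle
  rw [← lintegral_rnDeriv_mul hac hLm.aemeasurable]
  have hsup : ∀ x, L x * L x = ⨆ n, L x * F n x := fun x => by
    rw [← ENNReal.mul_iSup]
    congr 1
    change _ = ⨆ n : ℕ, min (L x) (n : ℝ≥0∞)
    rw [← inf_iSup_eq (L x) (fun n : ℕ => (n : ℝ≥0∞)), ENNReal.iSup_natCast, inf_top_eq]
  simp_rw [← hL, hsup]
  rw [lintegral_iSup (f := fun n x => L x * F n x) (fun n => hLm.mul (hFm n))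
    (fun m n hmn x => by dsimp only [F]; gcongr)]
  exact iSup_le hsq

variable {S : ℝ}

theorem integrable_rnDeriv [IsFiniteMeasure P] [IsFiniteMeasure Q] (h : ChiSqBound P Q C)
    (hC : C ≠ ∞) : Integrable (fun x => (P.rnDeriv Q x).toReal) P :=
  integrable_toReal_of_lintegral_ne_top (Measure.measurable_rnDeriv _ _).aemeasurable
    (ne_top_of_le_ne_top hC h.lintegral_rnDeriv_le)

theorem integral_rnDeriv_le [IsFiniteMeasure P] [IsFiniteMeasure Q]
    (h : ChiSqBound P Q (ENNReal.ofReal (exp (2 * S)))) :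
    ∫ x, (P.rnDeriv Q x).toReal ∂P ≤ exp (2 * S) := by
  rw [integral_toReal (Measure.measurable_rnDeriv _ _).aemeasurable
    (h.absolutelyContinuous (Measure.rnDeriv_lt_top P Q))]
  exact ENNReal.toReal_le_of_le_ofReal (exp_pos _).le h.lintegral_rnDeriv_le

theorem dKL_le [IsProbabilityMeasure P] [IsFiniteMeasure Q] (hS : 0 ≤ S)
    (h : ChiSqBound P Q (ENNReal.ofReal (exp (2 * S)))) : dKL P Q ≤ 2 * S := by
  have hac := h.absolutelyContinuous
  by_cases hint : Integrable (fun x => log (P.rnDeriv Q x).toReal) P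
  swap
  · rw [dKL, integral_undef hint]; positivity
  have hLi := h.integrable_rnDeriv ENNReal.ofReal_ne_top
  calc dKL P Q
      ≤ ∫ x, ((P.rnDeriv Q x).toReal * exp (-(2 * S)) + (2 * S - 1)) ∂P := by
        refine integral_mono_ae hint ((hLi.mul_const _).add (integrable_const _)) ?_
        filter_upwards [Measure.rnDeriv_pos hac, hac (Measure.rnDeriv_lt_top P Q)] with x h0 h1
        have hpos : 0 < (P.rnDeriv Q x).toReal := ENNReal.toReal_pos h0.ne' h1.ne
        have := log_le_sub_one_of_pos (mul_pos hpos (exp_pos (-(2 * S))))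
        rw [log_mul hpos.ne' (exp_pos _).ne', log_exp] at this
        linarith
    _ = (∫ x, (P.rnDeriv Q x).toReal ∂P) * exp (-(2 * S)) + (2 * S - 1) := by
        rw [integral_add (hLi.mul_const _) (integrable_const _), integral_mul_const]
        simp
    _ ≤ exp (2 * S) * exp (-(2 * S)) + (2 * S - 1) := by
        gcongr
        exact h.integral_rnDeriv_le
    _ = 2 * S := by rw [← exp_add]; simp

theorem dH_eq [IsFiniteMeasure P] [IsFiniteMeasure Q] (hac : P ≪ Q) :
    dH P Q = √(∫ x, (√(P.rnDeriv Q x).toReal - 1) ^ 2 ∂Q) := by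
  have hQ : Q ≪ P + Q := Measure.le_add_left le_rfl |>.absolutelyContinuous
  rw [dH, ← integral_toReal_rnDeriv_mul hQ]
  congr 1
  refine integral_congr_ae ?_
  filter_upwards [Measure.rnDeriv_mul_rnDeriv (κ := P + Q) hac] with x hx
  rw [← hx, Pi.mul_apply, ENNReal.toReal_mul, sqrt_mul ENNReal.toReal_nonneg]
  have := sq_sqrt (ENNReal.toReal_nonneg (a := Q.rnDeriv (P + Q) x))
  linear_combination (√(P.rnDeriv Q x).toReal - 1) ^ 2 * this

/-- Tangent line bound for `x ↦ x ^ (-1/2)` at `b⁻²`, multiplied by `x`. -/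
theorem sqrt_sub_one_sq_le {x b : ℝ} (hx : 0 ≤ x) (hb : 0 ≤ b) :
    (√x - 1) ^ 2 ≤ x + 1 - b * (3 * x - b ^ 2 * x ^ 2) := by
  obtain ⟨y, hy, rfl⟩ : ∃ y, 0 ≤ y ∧ x = y ^ 2 := ⟨√x, sqrt_nonneg _, (sq_sqrt hx).symm⟩
  rw [sqrt_sq hy]
  have : 0 ≤ y * ((b * y - 1) ^ 2 * (b * y + 2)) := by positivity
  linear_combination this

theorem dH_le [IsProbabilityMeasure P] [IsProbabilityMeasure Q]
    (h : ChiSqBound P Q (ENNReal.ofReal (exp (2 * S)))) :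
    dH P Q ≤ √(2 * S) := by
  have hac := h.absolutelyContinuous
  rw [dH_eq hac]
  refine sqrt_le_sqrt ?_
  set L : X → ℝ := fun x => (P.rnDeriv Q x).toReal with hL
  have hLi : Integrable L P := h.integrable_rnDeriv ENNReal.ofReal_ne_top
  have hLQ : Integrable L Q := Measure.integrable_toReal_rnDeriv
  have hL2 : Integrable (fun x => L x * L x) Q := (integrable_toReal_rnDeriv_mul_iff hac).2 hLi
  have hI1 : ∫ x, L x ∂Q = 1 := by simp [hL, Measure.integral_toReal_rnDeriv hac]
  have hI2 : ∫ x, L x * L x ∂Q ≤ exp (2 * S) :=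
    (integral_toReal_rnDeriv_mul hac).trans_le h.integral_rnDeriv_le
  set b := exp (-S) with hb
  have hsum : Integrable (fun x => (1 - 3 * b) * L x + b ^ 3 * (L x * L x)) Q :=
    (hLQ.const_mul _).add (hL2.const_mul _)
  have hb0 : 0 < b := exp_pos _
  calc ∫ x, (√(L x) - 1) ^ 2 ∂Q
      ≤ ∫ x, ((1 - 3 * b) * L x + b ^ 3 * (L x * L x) + 1) ∂Q := by
        refine integral_mono_of_nonneg (.of_forall fun x => sq_nonneg _)
          (hsum.add (integrable_const _))
          (.of_forall fun x => ?_)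
        have := sqrt_sub_one_sq_le (x := L x) ENNReal.toReal_nonneg hb0.le
        dsimp only
        linarith
    _ = (1 - 3 * b) + b ^ 3 * (∫ x, L x * L x ∂Q) + 1 := by
        rw [integral_add hsum (integrable_const _),
          integral_add (hLQ.const_mul _) (hL2.const_mul _), integral_const_mul, integral_const_mul,
          hI1]
        simp
    _ ≤ (1 - 3 * b) + b ^ 3 * exp (2 * S) + 1 := by gcongr
    _ = 2 - 2 * b := by
        have : b ^ 3 * exp (2 * S) = b := by
          rw [hb, ← exp_nat_mul, ← exp_add]; congr 1; push_cast; ring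
        rw [this]; ring
    _ ≤ 2 * S := by linarith [add_one_le_exp (-S)]

end ChiSqBound

/-- If two laws on `ℂ^ℤ` satisfy the bound on functions of finitely many coordinates, then they
satisfy it on all functions. -/
theorem ChiSqBound.of_map_restrict {P Q : Measure (ℤ → ℂ)} [IsFiniteMeasure P] [IsFiniteMeasure Q]
    {C : ℝ≥0∞} (hC : C ≠ ∞)
    (h : ∀ J : Finset ℤ, ChiSqBound (P.map J.restrict) (Q.map J.restrict) C) :
    ChiSqBound P Q C := by
  intro f hf h0 ⟨M, hM⟩
  let I : ℕ → Finset ℤ := fun n => Finset.Icc (-n : ℤ) n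
  have hI : Monotone I := fun m n hmn => Finset.Icc_subset_Icc (by lia) (by lia)
  let ℱ : Filtration ℕ (MeasurableSpace.pi : MeasurableSpace (ℤ → ℂ)) :=
    { seq := fun n => Filtration.piFinset (X := fun _ : ℤ => ℂ) (I n)
      mono' := fun m n hmn => Filtration.piFinset.mono (hI hmn)
      le' := fun n => Filtration.piFinset.le (I n) }
  have hsup : ⨆ n, ℱ n = MeasurableSpace.pi := by
    refine le_antisymm (iSup_le ℱ.le) (iSup_le fun k => ?_)
    refine le_trans ?_ (le_iSup (fun n => (ℱ n : MeasurableSpace (ℤ → ℂ))) k.natAbs)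
    have hk : k ∈ I k.natAbs := Finset.mem_Icc.2 (by lia)
    have : (fun x : ℤ → ℂ => x k) = (fun y => y ⟨k, hk⟩) ∘ (I k.natAbs).restrict := rfl
    rw [this, ← MeasurableSpace.comap_comp]
    exact MeasurableSpace.comap_mono (measurable_pi_apply _).comap_le
  have hfi : Integrable f (P + Q) :=
    Integrable.of_bound hf.aestronglyMeasurable M
      (.of_forall fun x => by simpa [abs_of_nonneg (h0 x)] using hM x)
  have hlim : ∀ᵐ x ∂(P + Q),
      Filter.Tendsto (fun n => ((P + Q)[f | ℱ n]) x) Filter.atTop (nhds (f x)) := by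
    have := tendsto_ae_condExp (μ := P + Q) (ℱ := ℱ) f
    rwa [hsup, condExp_of_stronglyMeasurable le_rfl hf.stronglyMeasurable hfi] at this
  have hfac : ∀ n, ∃ u : (I n → ℂ) → ℝ, Measurable u ∧ (P + Q)[f | ℱ n] = u ∘ (I n).restrict :=
    fun n => (stronglyMeasurable_condExp (m := ℱ n)).measurable.exists_eq_measurable_comp
  choose u hu huf using hfac
  let v : (n : ℕ) → (I n → ℂ) → ℝ := fun n y => max 0 (min (u n y) M)
  have hv : ∀ n, Measurable (v n) := fun n => measurable_const.max ((hu n).min measurable_const)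
  have hvM : ∀ n y, v n y ≤ max 0 M := fun n y => max_le_max le_rfl (min_le_right _ _)
  have hres : ∀ n, Measurable ((I n).restrict : (ℤ → ℂ) → I n → ℂ) := fun n =>
    Finset.measurable_restrict _
  have key : ∀ n, (∫⁻ x, ENNReal.ofReal (v n ((I n).restrict x)) ∂P) ^ 2
      ≤ C * ∫⁻ x, ENNReal.ofReal (v n ((I n).restrict x)) ^ 2 ∂Q := fun n => by
    have := h (I n) (v n) (hv n) (fun y => le_max_left _ _) ⟨max 0 M, hvM n⟩
    rwa [lintegral_map (hv n).ennreal_ofReal (hres n),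
      lintegral_map ((hv n).ennreal_ofReal.pow_const 2) (hres n)] at this
  have hvlim : ∀ᵐ x ∂(P + Q), Filter.Tendsto (fun n => ENNReal.ofReal (v n ((I n).restrict x)))
      Filter.atTop (nhds (ENNReal.ofReal (f x))) := by
    filter_upwards [hlim] with x hx
    have h1 : max 0 (min (f x) M) = f x := by rw [min_eq_left (hM x), max_eq_right (h0 x)]
    rw [← h1]
    refine ENNReal.tendsto_ofReal
      (tendsto_const_nhds.max (Filter.Tendsto.min ?_ tendsto_const_nhds))
    simpa only [huf, Function.comp_apply] using hx
  have hvm : ∀ n, Measurable fun x : ℤ → ℂ => ENNReal.ofReal (v n ((I n).restrict x)) := fun n =>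
    (hv n).ennreal_ofReal.comp (hres n)
  have hb : ∀ n (x : ℤ → ℂ),
      ENNReal.ofReal (v n ((I n).restrict x)) ≤ ENNReal.ofReal (max 0 M) := fun n x =>
    ENNReal.ofReal_le_ofReal (hvM n _)
  have hP : ∀ᵐ x ∂P, Filter.Tendsto (fun n => ENNReal.ofReal (v n ((I n).restrict x)))
      Filter.atTop (nhds (ENNReal.ofReal (f x))) := (ae_add_measure_iff.1 hvlim).1
  have hQ : ∀ᵐ x ∂Q, Filter.Tendsto (fun n => ENNReal.ofReal (v n ((I n).restrict x)))
      Filter.atTop (nhds (ENNReal.ofReal (f x))) := (ae_add_measure_iff.1 hvlim).2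
  have lim1 := tendsto_lintegral_of_dominated_convergence (fun _ => ENNReal.ofReal (max 0 M)) hvm
    (fun n => .of_forall (hb n)) (by simp [ENNReal.mul_eq_top]) hP
  have lim2 := tendsto_lintegral_of_dominated_convergence (fun _ => ENNReal.ofReal (max 0 M) ^ 2)
    (fun n => (hvm n).pow_const 2)
    (fun n => .of_forall fun x => pow_le_pow_left' (hb n x) 2)
    (by simp [ENNReal.mul_eq_top]) (hQ.mono fun x hx => ENNReal.Tendsto.pow hx)
  exact le_of_tendsto_of_tendsto' (ENNReal.Tendsto.pow lim1)
    (ENNReal.Tendsto.const_mul lim2 (Or.inr hC)) key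

theorem lintegral_mul_sq_le {X : Type*} [MeasurableSpace X] (μ : Measure X) {f g : X → ℝ≥0∞}
    (hf : Measurable f) (hg : Measurable g) :
    (∫⁻ x, f x * g x ∂μ) ^ 2 ≤ (∫⁻ x, f x ^ 2 ∂μ) * ∫⁻ x, g x ^ 2 ∂μ := by
  have := ENNReal.lintegral_mul_le_Lp_mul_Lq μ Real.HolderConjugate.two_two hf.aemeasurable
    hg.aemeasurable
  simp only [ENNReal.rpow_two, Pi.mul_apply] at this
  calc _ ≤ _ := pow_le_pow_left' this 2
    _ = _ := by
      rw [mul_pow, ← ENNReal.rpow_natCast, ← ENNReal.rpow_natCast, ← ENNReal.rpow_mul,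
        ← ENNReal.rpow_mul]
      norm_num

theorem ChiSqBound.withDensity {X : Type*} [MeasurableSpace X] (μ : Measure X) {R : X → ℝ≥0∞}
    (hR : Measurable R) : ChiSqBound (μ.withDensity R) μ (∫⁻ x, R x ^ 2 ∂μ) := by
  intro f hf _ _
  rw [lintegral_withDensity_eq_lintegral_mul _ hR hf.ennreal_ofReal]
  exact lintegral_mul_sq_le μ hR hf.ennreal_ofReal

theorem ChiSqBound.mono {X : Type*} [MeasurableSpace X] {P Q : Measure X} {C D : ℝ≥0∞}
    (h : ChiSqBound P Q C) (hCD : C ≤ D) : ChiSqBound P Q D := fun f hf h0 hM =>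
  (h f hf h0 hM).trans (by gcongr)

/-- The bound is stable under mixtures. -/
theorem ChiSqBound.bind {X Y : Type*} [MeasurableSpace X] [MeasurableSpace Y] {g : Measure Y}
    [IsProbabilityMeasure g] {κ η : Y → Measure X} (hκ : Measurable κ) (hη : Measurable η)
    {C : ℝ≥0∞} (h : ∀ y, ChiSqBound (κ y) (η y) C) :
    ChiSqBound (g.bind κ) (g.bind η) C := by
  intro f hf h0 hM
  have hf' := hf.ennreal_ofReal
  rw [Measure.lintegral_bind hκ.aemeasurable hf'.aemeasurable,
    Measure.lintegral_bind hη.aemeasurable (hf'.pow_const 2).aemeasurable]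
  have hm : Measurable fun y => ∫⁻ x, ENNReal.ofReal (f x) ∂κ y :=
    (Measure.measurable_lintegral hf').comp hκ
  have := lintegral_mul_sq_le g hm (measurable_const (a := (1 : ℝ≥0∞)))
  simp only [mul_one, one_pow, lintegral_const, measure_univ] at this
  refine this.trans ?_
  have hm' : Measurable fun y => ∫⁻ x, ENNReal.ofReal (f x) ^ 2 ∂η y :=
    (Measure.measurable_lintegral (hf'.pow_const 2)).comp hη
  rw [← lintegral_const_mul _ hm']
  exact lintegral_mono fun y => h y f hf h0 hM

theorem lintegral_pi_prod {ι : Type*} [Fintype ι] {X : ι → Type*} [∀ i, MeasurableSpace (X i)]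
    (μ : ∀ i, Measure (X i)) [∀ i, IsProbabilityMeasure (μ i)] {f : ∀ i, X i → ℝ≥0∞}
    (hf : ∀ i, Measurable (f i)) :
    ∫⁻ x, ∏ i, f i (x i) ∂Measure.pi μ = ∏ i, ∫⁻ y, f i y ∂μ i := by
  refine (ProbabilityTheory.lintegral_prod_eq_prod_lintegral_of_indepFun Finset.univ
    (fun i (x : ∀ i, X i) => f i (x i))
    (ProbabilityTheory.iIndepFun_pi fun i => (hf i).aemeasurable)
    (fun i => (hf i).comp (measurable_pi_apply i))).trans ?_
  exact Finset.prod_congr rfl fun i _ =>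
    (measurePreserving_eval μ i).lintegral_comp (hf i)

theorem pi_withDensity {ι : Type*} [Fintype ι] {X : ι → Type*} [∀ i, MeasurableSpace (X i)]
    (μ : ∀ i, Measure (X i)) [∀ i, IsProbabilityMeasure (μ i)] {f : ∀ i, X i → ℝ≥0∞}
    (hf : ∀ i, Measurable (f i)) [∀ i, SigmaFinite ((μ i).withDensity (f i))] :
    Measure.pi (fun i => (μ i).withDensity (f i))
      = (Measure.pi μ).withDensity fun x => ∏ i, f i (x i) := by
  refine Measure.pi_eq (μ := fun i => (μ i).withDensity (f i)) fun s hs => ?_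
  rw [withDensity_apply _ (MeasurableSet.univ_pi hs),
    ← lintegral_indicator (MeasurableSet.univ_pi hs)]
  have : ∀ x : ∀ i, X i, (univ.pi s).indicator (fun x => ∏ i, f i (x i)) x
      = ∏ i, (s i).indicator (f i) (x i) := fun x => by
    by_cases hx : x ∈ univ.pi s
    · rw [indicator_of_mem hx]
      exact Finset.prod_congr rfl fun i _ => (indicator_of_mem (hx i (mem_univ i)) _).symm
    · rw [indicator_of_notMem hx]
      simp only [mem_univ_pi, not_forall] at hx
      obtain ⟨i, hi⟩ := hx
      exact (Finset.prod_eq_zero (Finset.mem_univ i) (indicator_of_notMem hi _)).symm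
  simp_rw [this]
  rw [lintegral_pi_prod μ fun i => (hf i).indicator (hs i)]
  exact Finset.prod_congr rfl fun i _ => by
    rw [lintegral_indicator (hs i), withDensity_apply _ (hs i)]

/-- The bound tensorizes for measures given by densities. -/
theorem ChiSqBound.pi {ι : Type*} [Fintype ι] {X : ι → Type*} [∀ i, MeasurableSpace (X i)]
    (μ ν : ∀ i, Measure (X i)) [∀ i, IsProbabilityMeasure (μ i)] [∀ i, IsProbabilityMeasure (ν i)]
    {f : ∀ i, X i → ℝ≥0∞} (hf : ∀ i, Measurable (f i)) (hμν : ∀ i, μ i = (ν i).withDensity (f i)) :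
    ChiSqBound (Measure.pi μ) (Measure.pi ν) (∏ i, ∫⁻ x, f i x ^ 2 ∂ν i) := by
  have : ∀ i, IsProbabilityMeasure ((ν i).withDensity (f i)) := fun i => by
    rw [← hμν i]; infer_instance
  rw [funext hμν, pi_withDensity ν hf, ← lintegral_pi_prod ν fun i => (hf i).pow_const 2]
  simp_rw [Finset.prod_pow]
  exact ChiSqBound.withDensity _ (Finset.measurable_prod _ fun i _ =>
    (hf i).comp (measurable_pi_apply i))

theorem lintegral_gaussC_density (a : ℂ) :
    ∫⁻ z : ℂ, ENNReal.ofReal (π⁻¹ * exp (-‖z - a‖ ^ 2)) = 1 := by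
  have h0 : ∫ z : ℂ, exp (-‖z - a‖ ^ 2) = π := by
    have := GaussianFourier.integral_rexp_neg_mul_sq_norm (V := ℂ) one_pos
    rw [integral_sub_right_eq_self (fun z : ℂ => exp (-‖z‖ ^ 2)) a]
    simpa using this
  have h1 : ∫ z : ℂ, π⁻¹ * exp (-‖z - a‖ ^ 2) = 1 := by
    rw [integral_const_mul, h0, inv_mul_cancel₀ pi_ne_zero]
  rw [← ofReal_integral_eq_lintegral_ofReal (Integrable.of_integral_ne_zero (by simp [h1]))
    (.of_forall fun z => by positivity), h1, ENNReal.ofReal_one]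

instance (a : ℂ) : IsProbabilityMeasure (gaussC a) :=
  ⟨by rw [gaussC, withDensity_apply _ MeasurableSet.univ, Measure.restrict_univ,
    lintegral_gaussC_density]⟩

/-- The density of `gaussC a` with respect to `gaussC b`. -/
noncomputable def gaussCRatio (a b z : ℂ) : ℝ≥0∞ :=
  ENNReal.ofReal (exp (‖z - b‖ ^ 2 - ‖z - a‖ ^ 2))

theorem measurable_gaussCRatio (a b : ℂ) : Measurable (gaussCRatio a b) := by
  unfold gaussCRatio; fun_prop

theorem gaussC_eq_withDensity (a b : ℂ) :
    gaussC a = (gaussC b).withDensity (gaussCRatio a b) := by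
  rw [gaussC, gaussC, ← withDensity_mul _ (by fun_prop) (measurable_gaussCRatio a b)]
  congr 1
  ext z
  rw [Pi.mul_apply, gaussCRatio, ← ENNReal.ofReal_mul (by positivity), mul_assoc, ← exp_add]
  ring_nf

theorem lintegral_gaussCRatio_sq (a b : ℂ) :
    ∫⁻ z, gaussCRatio a b z ^ 2 ∂gaussC b = ENNReal.ofReal (exp (2 * ‖a - b‖ ^ 2)) := by
  rw [gaussC, lintegral_withDensity_eq_lintegral_mul _ (by fun_prop)
    ((measurable_gaussCRatio a b).pow_const 2)]
  have : ∀ z : ℂ, ENNReal.ofReal (π⁻¹ * exp (-‖z - b‖ ^ 2)) * gaussCRatio a b z ^ 2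
      = ENNReal.ofReal (exp (2 * ‖a - b‖ ^ 2))
        * ENNReal.ofReal (π⁻¹ * exp (-‖z - (2 * a - b)‖ ^ 2)) := fun z => by
    rw [gaussCRatio, ← ENNReal.ofReal_pow (exp_pos _).le, ← ENNReal.ofReal_mul (by positivity),
      ← ENNReal.ofReal_mul (by positivity), ← exp_nat_mul, mul_left_comm, mul_assoc, ← exp_add,
      ← exp_add]
    congr 3
    simp only [Complex.sq_norm, Complex.normSq_apply, Complex.sub_re, Complex.sub_im,
      Complex.mul_re, Complex.mul_im, Complex.re_ofNat, Complex.im_ofNat]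
    push_cast
    ring
  simp only [Pi.mul_apply, this]
  rw [lintegral_const_mul _ (by fun_prop), lintegral_gaussC_density, mul_one]

theorem norm_rotZ_sub (θ η : ℤ → ℂ) (φ : ℝ) (k : ℤ) :
    ‖rotZ θ φ k - rotZ η φ k‖ = ‖θ k - η k‖ := by
  have : -Complex.I * (2 * π * ((k : ℝ) : ℂ) * φ) = ((-(2 * π * k * φ) : ℝ) : ℂ) * Complex.I := by
    push_cast; ring
  rw [rotZ, rotZ, ← sub_mul, norm_mul, this, Complex.norm_exp_ofReal_mul_I, mul_one]

theorem IsGaussProduct.chiSqBound {θ η : ℤ → ℂ} {φ : ℝ} {P Q : Measure (ℤ → ℂ)}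
    (hP : IsGaussProduct θ φ P) (hQ : IsGaussProduct η φ Q)
    (hs : Summable fun k => ‖θ k - η k‖ ^ 2) :
    ChiSqBound P Q (ENNReal.ofReal (exp (2 * ∑' k, ‖θ k - η k‖ ^ 2))) := by
  have := hP.1
  have := hQ.1
  refine ChiSqBound.of_map_restrict ENNReal.ofReal_ne_top fun J => ?_
  rw [hP.2 J, hQ.2 J]
  refine (ChiSqBound.pi _ _ (fun k : J => measurable_gaussCRatio (rotZ θ φ k) (rotZ η φ k))
    fun k => gaussC_eq_withDensity _ _).mono ?_
  simp only [lintegral_gaussCRatio_sq, norm_rotZ_sub]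
  rw [← ENNReal.ofReal_prod_of_nonneg fun _ _ => (exp_pos _).le, ← exp_sum, ← Finset.mul_sum,
    Finset.sum_coe_sort J fun k => ‖θ k - η k‖ ^ 2]
  gcongr
  exact hs.sum_le_tsum J fun _ _ => sq_nonneg _

theorem measurable_gaussC_rotZ (θ : ℤ → ℂ) (k : ℤ) : Measurable fun φ => gaussC (rotZ θ φ k) := by
  refine Measure.measurable_of_measurable_coe _ fun s hs => ?_
  simp only [gaussC, withDensity_apply _ hs]
  refine Measurable.lintegral_prod_right' (ν := volume.restrict s)
    (f := fun p : ℝ × ℂ => ENNReal.ofReal (π⁻¹ * exp (-‖p.2 - rotZ θ p.1 k‖ ^ 2))) ?_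
  unfold rotZ
  fun_prop

theorem measurable_of_isGaussProduct {θ : ℤ → ℂ} {Pp : ℝ → Measure (ℤ → ℂ)}
    (h : ∀ φ, IsGaussProduct θ φ (Pp φ)) : Measurable Pp := by
  have := fun φ => (h φ).1
  refine Measurable.measure_of_isPiSystem_of_isProbabilityMeasure
    (generateFrom_squareCylinders (α := fun _ : ℤ => ℂ)).symm
    (isPiSystem_squareCylinders (fun _ => MeasurableSpace.isPiSystem_measurableSet) (by simp)) ?_
  rintro _ ⟨s, t, ht, rfl⟩
  have ht' : ∀ k, MeasurableSet (t k) := fun k => ht k (mem_univ k)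
  have hpre : (s : Set ℤ).pi t = s.restrict ⁻¹' (univ.pi fun k : s => t k) := by
    ext x; simp
  have : ∀ φ, Pp φ ((s : Set ℤ).pi t) = ∏ k : s, gaussC (rotZ θ φ k) (t k) := fun φ => by
    rw [hpre, ← Measure.map_apply (Finset.measurable_restrict s)
      (MeasurableSet.univ_pi fun k => ht' k), (h φ).2 s, Measure.pi_pi]
  simp_rw [this]
  exact Finset.measurable_prod _ fun k _ =>
    (Measure.measurable_coe (ht' k)).comp (measurable_gaussC_rotZ θ k)

theorem IsMixtureLaw.exists_eq_bind {θ : ℤ → ℂ} {g : Measure ℝ} {P : Measure (ℤ → ℂ)}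
    (h : IsMixtureLaw θ g P) :
    ∃ Pp : ℝ → Measure (ℤ → ℂ), (∀ φ, IsGaussProduct θ φ (Pp φ)) ∧ P = g.bind Pp := by
  obtain ⟨Pp, hPp, hP⟩ := h
  refine ⟨Pp, hPp, Measure.ext fun A hA => ?_⟩
  rw [hP A hA, Measure.bind_apply hA (measurable_of_isGaussProduct hPp).aemeasurable]

theorem IsMixtureLaw.isProbabilityMeasure {θ : ℤ → ℂ} {g : Measure ℝ} [IsProbabilityMeasure g]
    {P : Measure (ℤ → ℂ)} (h : IsMixtureLaw θ g P) : IsProbabilityMeasure P := by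
  obtain ⟨Pp, hPp, hP⟩ := h
  have := fun φ => (hPp φ).1
  exact ⟨by simp [hP univ MeasurableSet.univ]⟩

theorem IsMixtureLaw.chiSqBound {θ η : ℤ → ℂ} {g : Measure ℝ} [IsProbabilityMeasure g]
    {P Q : Measure (ℤ → ℂ)} (hP : IsMixtureLaw θ g P) (hQ : IsMixtureLaw η g Q)
    (hs : Summable fun k => ‖θ k - η k‖ ^ 2) :
    ChiSqBound P Q (ENNReal.ofReal (exp (2 * ∑' k, ‖θ k - η k‖ ^ 2))) := by
  obtain ⟨Pp, hPp, rfl⟩ := hP.exists_eq_bind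
  obtain ⟨Qp, hQp, rfl⟩ := hQ.exists_eq_bind
  exact ChiSqBound.bind (measurable_of_isGaussProduct hPp) (measurable_of_isGaussProduct hQp)
    fun φ => (hPp φ).chiSqBound (hQp φ) hs

theorem norm_sub_trunc_le (θ : ℤ → ℂ) (ℓ : ℕ) (k : ℤ) : ‖θ k - trunc θ ℓ k‖ ≤ ‖θ k‖ := by
  unfold trunc
  split_ifs <;> simp

theorem norm_sub_trunc_sq_le (θ : ℤ → ℂ) {ℓ : ℕ} (hℓ : 1 ≤ ℓ) {s : ℝ} (hs : 0 ≤ s) (k : ℤ) :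
    ‖θ k - trunc θ ℓ k‖ ^ 2 ≤ (ℓ : ℝ) ^ (-(2 * s)) * ((|k| : ℝ) ^ (2 * s) * ‖θ k‖ ^ 2) := by
  have hℓ' : (0 : ℝ) < ℓ := by exact_mod_cast hℓ
  by_cases hk : |k| ≤ (ℓ : ℤ)
  · simp only [trunc, hk, if_true, sub_self, norm_zero, zero_pow two_ne_zero]
    positivity
  · have hk' : (ℓ : ℝ) ≤ |(k : ℝ)| := by exact_mod_cast (not_le.1 hk).le
    simp only [trunc, hk, if_false, sub_zero]
    rw [← mul_assoc]
    refine le_mul_of_one_le_left (sq_nonneg _) ?_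
    rw [rpow_neg hℓ'.le, inv_mul_eq_div, one_le_div (by positivity)]
    gcongr

theorem l2norm_sub_trunc_le {θ : ℤ → ℂ} {ℓ : ℕ} (hℓ : 1 ≤ ℓ) {s : ℝ} (hs : 0 ≤ s)
    (hsum : Summable fun k : ℤ => (|k| : ℝ) ^ (2 * s) * ‖θ k‖ ^ 2) :
    l2norm (fun k => θ k - trunc θ ℓ k)
      ≤ √(∑' k : ℤ, (|k| : ℝ) ^ (2 * s) * ‖θ k‖ ^ 2) * (ℓ : ℝ) ^ (-s) := by
  have hle : ∑' k, ‖θ k - trunc θ ℓ k‖ ^ 2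
      ≤ (ℓ : ℝ) ^ (-(2 * s)) * ∑' k : ℤ, (|k| : ℝ) ^ (2 * s) * ‖θ k‖ ^ 2 := by
    rw [← tsum_mul_left]
    exact Summable.tsum_le_tsum (norm_sub_trunc_sq_le θ hℓ hs)
      (.of_nonneg_of_le (fun _ => sq_nonneg _) (norm_sub_trunc_sq_le θ hℓ hs) (hsum.mul_left _))
      (hsum.mul_left _)
  have hpow : (ℓ : ℝ) ^ (-(2 * s)) = ((ℓ : ℝ) ^ (-s)) ^ 2 := by
    rw [← rpow_mul_natCast (Nat.cast_nonneg _)]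
    congr 1; push_cast; ring
  calc l2norm (fun k => θ k - trunc θ ℓ k)
      ≤ √(((ℓ : ℝ) ^ (-s)) ^ 2 * ∑' k : ℤ, (|k| : ℝ) ^ (2 * s) * ‖θ k‖ ^ 2) :=
        sqrt_le_sqrt (hpow ▸ hle)
    _ = _ := by rw [sqrt_mul (sq_nonneg _), sqrt_sq (by positivity), mul_comm]

/-- KL(P_{θ⁰,g⁰} ‖ P_{θ⁰_ℓ,g⁰}) ≤ 2‖θ⁰ − θ⁰_ℓ‖², hence
d_H(P_{θ⁰,g⁰}, P_{θ⁰_ℓ,g⁰}) ≤ √2 ‖θ⁰ − θ⁰_ℓ‖ ≤ √2 Q_s ℓ^{−s} under a Sobolev condition. -/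
theorem kl_and_hellinger_truncation (θ0 : ℤ → ℂ)
    (hθ0 : Summable (fun k : ℤ => ‖θ0 k‖ ^ 2)) (ℓ : ℕ) (hℓ : 1 ≤ ℓ)
    (g0 : Measure ℝ) (hg0 : IsProbOn01 g0)
    (P Q : Measure (ℤ → ℂ))
    (hP : IsMixtureLaw θ0 g0 P) (hQ : IsMixtureLaw (trunc θ0 ℓ) g0 Q) :
    P ≪ Q ∧
    dKL P Q ≤ 2 * l2norm (fun k => θ0 k - trunc θ0 ℓ k) ^ 2 ∧
    dH P Q ≤ Real.sqrt 2 * l2norm (fun k => θ0 k - trunc θ0 ℓ k) ∧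
    ∀ s : ℝ, 1 ≤ s → Summable (fun k : ℤ => (|k| : ℝ) ^ (2 * s) * ‖θ0 k‖ ^ 2) →
      dH P Q ≤ Real.sqrt 2
        * Real.sqrt (∑' k : ℤ, (|k| : ℝ) ^ (2 * s) * ‖θ0 k‖ ^ 2) * (ℓ : ℝ) ^ (-s) := by
  have := hg0.1
  have := hP.isProbabilityMeasure
  have := hQ.isProbabilityMeasure
  have hs : Summable fun k => ‖θ0 k - trunc θ0 ℓ k‖ ^ 2 :=
    .of_nonneg_of_le (fun _ => sq_nonneg _)
      (fun k => pow_le_pow_left₀ (norm_nonneg _) (norm_sub_trunc_le θ0 ℓ k) 2) hθ0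
  have h := hP.chiSqBound hQ hs
  have hS : 0 ≤ ∑' k, ‖θ0 k - trunc θ0 ℓ k‖ ^ 2 := tsum_nonneg fun _ => sq_nonneg _
  have hH : dH P Q ≤ √2 * l2norm (fun k => θ0 k - trunc θ0 ℓ k) := by
    rw [l2norm, ← sqrt_mul zero_le_two]
    exact h.dH_le
  refine ⟨h.absolutelyContinuous, ?_, hH, fun s hs1 hsum => ?_⟩
  · rw [l2norm, sq_sqrt hS]
    exact h.dKL_le hS
  · rw [mul_assoc]
    exact hH.trans (by gcongr; exact l2norm_sub_trunc_le hℓ (zero_le_one.trans hs1) hsum)
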